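/- arXiv:2107.05793 — 3 statements merged into one kernel-verified Lean document; each statement's English description precedes it below -/
import Mathlib

section
/- Let G = (V, E) be a finite simple graph and b : V → ℕ a function of degree bounds. The family of b-matchings of G is a 2-extendible system: if A ⊆ B are b-matchings, e ∈ E \ A is an edge such that A ∪ {e} is a b-matching, then there exists a set Y ⊆ B \ A with |Y| ≤ 2 such that (B \ Y) ∪ {e} is a b-matching. -/
/-- `M` is a `b`-matching of the simple graph `G`: a set of edges of `G` such that
every vertex `v` is incident to at most `b v` edges of `M`. -/
def IsBMatching {V : Type*} [Fintype V] [DecidableEq V] (G : SimpleGraph V)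
    [DecidableRel G.Adj] (b : V → ℕ) (M : Finset (Sym2 V)) : Prop :=
  M ⊆ G.edgeFinset ∧ ∀ v : V, (M.filter (fun e => v ∈ e)).card ≤ b v

/-- If fewer than `k` elements of `A` satisfy `p`, while at most `k` elements of `B` do,
then removing at most one element of `B \ A` from `B` leaves fewer than `k` elements
satisfying `p`. -/
theorem Finset.exists_card_le_one_card_filter_sdiff_lt {α : Type*} [DecidableEq α]
    (p : α → Prop) [DecidablePred p] {A B : Finset α} {k : ℕ}
    (hA : (A.filter p).card < k) (hB : (B.filter p).card ≤ k) :
    ∃ Y ⊆ B \ A, Y.card ≤ 1 ∧ ((B \ Y).filter p).card < k := by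
  rcases hB.lt_or_eq with h | h
  · exact ⟨∅, by simp, by simp, by simpa using h⟩
  · obtain ⟨x, hxB, hxA⟩ := Finset.exists_mem_notMem_of_card_lt_card (h ▸ hA)
    rw [Finset.mem_filter] at hxB hxA
    refine ⟨{x}, ?_, by simp, h ▸ Finset.card_lt_card ?_⟩
    · rw [Finset.singleton_subset_iff, Finset.mem_sdiff]
      exact ⟨hxB.1, fun hx => hxA ⟨hx, hxB.2⟩⟩
    · refine Finset.ssubset_iff_subset_ne.2
        ⟨Finset.filter_subset_filter p Finset.sdiff_subset, fun heq => ?_⟩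
      have hx : x ∈ (B \ {x}).filter p := heq ▸ Finset.mem_filter.2 hxB
      simp at hx

/-- The family of `b`-matchings of a finite simple graph is a
2-extendible system. -/
theorem bMatching_two_extendible {V : Type*} [Fintype V] [DecidableEq V]
    (G : SimpleGraph V) [DecidableRel G.Adj] (b : V → ℕ)
    (A B : Finset (Sym2 V)) (hA : IsBMatching G b A) (hB : IsBMatching G b B)
    (hAB : A ⊆ B) (e : Sym2 V) (heE : e ∈ G.edgeFinset) (heA : e ∉ A)
    (hAe : IsBMatching G b (A ∪ {e})) :
    ∃ Y ⊆ B \ A, Y.card ≤ 2 ∧ IsBMatching G b ((B \ Y) ∪ {e}) := by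
  have free (v : V) (hv : v ∈ e) : (A.filter (fun f => v ∈ f)).card < b v := by
    have h := hAe.2 v
    rwa [Finset.filter_union, Finset.filter_singleton, if_pos hv,
      Finset.card_union_of_disjoint (by simp [heA]), Finset.card_singleton] at h
  induction e with
  | h u w =>
    obtain ⟨Y, hY, hYc, hYu⟩ := Finset.exists_card_le_one_card_filter_sdiff_lt
      (fun f => u ∈ f) (free u (by simp)) (hB.2 u)
    obtain ⟨Z, hZ, hZc, hZw⟩ := Finset.exists_card_le_one_card_filter_sdiff_lt
      (fun f => w ∈ f) (free w (by simp)) (hB.2 w)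
    refine ⟨Y ∪ Z, Finset.union_subset hY hZ, (Finset.card_union_le Y Z).trans (by omega),
      Finset.union_subset (Finset.sdiff_subset.trans hB.1) (by simpa using heE), fun v => ?_⟩
    have mono {S T : Finset (Sym2 V)} (h : S ⊆ T) :
        (S.filter (fun f => v ∈ f)).card ≤ (T.filter (fun f => v ∈ f)).card :=
      Finset.card_le_card (Finset.filter_subset_filter _ h)
    rw [Finset.filter_union, Finset.filter_singleton]
    split_ifs with hv
    · refine (Finset.card_union_le _ _).trans ?_
      rw [Finset.card_singleton]
      rcases Sym2.mem_iff.1 hv with rfl | rfl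
      · exact (mono (Finset.sdiff_subset_sdiff le_rfl Finset.subset_union_left)).trans_lt hYu
      · exact (mono (Finset.sdiff_subset_sdiff le_rfl Finset.subset_union_right)).trans_lt hZw
    · rw [Finset.union_empty]
      exact (mono Finset.sdiff_subset).trans (hB.2 v)
end

section
/- Let G = (V, E) be a finite simple graph, b : V → ℕ degree bounds, f a normalized monotone submodular real-valued function on subsets of E, and ε ∈ (0, 1]. Let M = {e₁, …, e_k} be a maximal b-matching (no edge of E \ M is available with respect to M) admitting an ordering of its edges such that, for each i with M_{i-1} = {e₁, …, e_{i-1}}: (a) e_i is available with respect to M_{i-1}, and (b) for every edge e' adjacent to e_i that is available with respect to M_{i-1}, ρ_{e_i}(M_{i-1}) ≥ ε · ρ_{e'}(M_{i-1}). Then for every b-matching M* of G, f(M) ≥ (ε / (2 + ε)) · f(M*). -/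
/-- An edge `e ∈ E` is available with respect to `M` if `e ∉ M` and `M ∪ {e}`
is a `b`-matching. -/
def AvailableEdge {V : Type*} [Fintype V] [DecidableEq V] (G : SimpleGraph V)
    [DecidableRel G.Adj] (b : V → ℕ) (M : Finset (Sym2 V)) (e : Sym2 V) : Prop :=
  e ∈ G.edgeFinset ∧ e ∉ M ∧ IsBMatching G b (M ∪ {e})

/-- Two distinct edges are adjacent if they share an endpoint. -/
def EdgeAdjacent {V : Type*} (e e' : Sym2 V) : Prop :=
  e ≠ e' ∧ ∃ v : V, v ∈ e ∧ v ∈ e'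

/-- The set of the first `i` edges of the ordering `e : Fin k → Sym2 V`. -/
def prefixSet {V : Type*} [DecidableEq V] {k : ℕ} (e : Fin k → Sym2 V) (i : ℕ) :
    Finset (Sym2 V) :=
  (Finset.univ.filter (fun j : Fin k => (j : ℕ) < i)).image e

section PrefixSet

variable {V : Type*} [DecidableEq V] {k : ℕ}

lemma prefixSet_zero (e : Fin k → Sym2 V) : prefixSet e 0 = ∅ := by
  simp [prefixSet]

lemma prefixSet_of_le (e : Fin k → Sym2 V) {n : ℕ} (h : k ≤ n) :
    prefixSet e n = Finset.univ.image e := by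
  unfold prefixSet
  rw [Finset.filter_true_of_mem]
  intro j _
  exact j.2.trans_le h

lemma prefixSet_succ (e : Fin k → Sym2 V) (i : Fin k) :
    prefixSet e ((i : ℕ) + 1) = prefixSet e (i : ℕ) ∪ {e i} := by
  have h : Finset.univ.filter (fun j : Fin k => (j : ℕ) < (i : ℕ) + 1) =
      Finset.univ.filter (fun j : Fin k => (j : ℕ) < (i : ℕ)) ∪ {i} := by
    ext j
    simp [Fin.ext_iff]
    omega
  rw [prefixSet, h, Finset.image_union, Finset.image_singleton, prefixSet]

lemma prefixSet_subset_image (e : Fin k → Sym2 V) (n : ℕ) :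
    prefixSet e n ⊆ Finset.univ.image e :=
  Finset.image_subset_image (Finset.filter_subset _ _)

/-- The marginal gains along an ordering add up to the value of the whole set. -/
lemma sum_prefixSet_marginal (e : Fin k → Sym2 V) (f : Finset (Sym2 V) → ℝ) :
    ∑ j : Fin k, (f (prefixSet e (j : ℕ) ∪ {e j}) - f (prefixSet e (j : ℕ))) =
      f (Finset.univ.image e) - f ∅ := by
  simp_rw [← prefixSet_succ]
  rw [Fin.sum_univ_eq_sum_range (fun n => f (prefixSet e (n + 1)) - f (prefixSet e n)),
    Finset.sum_range_sub (fun n => f (prefixSet e n)), prefixSet_zero, prefixSet_of_le e le_rfl]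

end PrefixSet

lemma Sym2.card_filter_mem_le_two {V : Type*} [Fintype V] [DecidableEq V] (e : Sym2 V) :
    (Finset.univ.filter (fun v => v ∈ e)).card ≤ 2 := by
  induction e with
  | _ x y =>
    refine (Finset.card_le_card (t := {x, y}) ?_).trans Finset.card_le_two
    intro v
    simp

section BMatching

variable {V : Type*} [Fintype V] [DecidableEq V] {G : SimpleGraph V} [DecidableRel G.Adj]
  {b : V → ℕ}

lemma IsBMatching.mono {M N : Finset (Sym2 V)} (h : IsBMatching G b N) (hMN : M ⊆ N) :
    IsBMatching G b M :=
  ⟨hMN.trans h.1, fun v =>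
    (Finset.card_le_card (Finset.filter_subset_filter _ hMN)).trans (h.2 v)⟩

lemma IsBMatching.exists_saturated {M : Finset (Sym2 V)} (hM : IsBMatching G b M)
    {s : Sym2 V} (hs : s ∈ G.edgeFinset) (hsM : s ∉ M) (h : ¬ AvailableEdge G b M s) :
    ∃ v ∈ s, b v ≤ (M.filter (fun e => v ∈ e)).card := by
  by_contra! hc
  refine h ⟨hs, hsM, Finset.union_subset hM.1 (Finset.singleton_subset_iff.2 hs), fun v => ?_⟩
  rw [Finset.filter_union]
  by_cases hv : v ∈ s
  · have h1 := hc v hv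
    have h2 : (({s} : Finset (Sym2 V)).filter (fun e => v ∈ e)).card ≤ 1 :=
      Finset.card_filter_le _ _
    exact (Finset.card_union_le _ _).trans (by omega)
  · rw [Finset.filter_singleton, if_neg hv, Finset.union_empty]
    exact hM.2 v

lemma isBMatching_prefixSet {k : ℕ} {e : Fin k → Sym2 V}
    (ha : ∀ i : Fin k, AvailableEdge G b (prefixSet e (i : ℕ)) (e i)) (n : ℕ) :
    IsBMatching G b (prefixSet e n) := by
  rcases Nat.eq_zero_or_pos k with rfl | hk
  · simp [prefixSet, IsBMatching]
  · have h := (ha ⟨k - 1, by omega⟩).2.2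
    rw [← prefixSet_succ, prefixSet_of_le e (by simp; omega)] at h
    exact h.mono (prefixSet_subset_image e n)

/-- An edge which is available at first but not at the end is blocked at an endpoint `v` by at
least `b v` edges of the ordering, each chosen while the blocked edge was still available. -/
lemma exists_endpoint_blocked {k : ℕ} {e : Fin k → Sym2 V}
    (ha : ∀ i : Fin k, AvailableEdge G b (prefixSet e (i : ℕ)) (e i))
    {s : Sym2 V} (hs : AvailableEdge G b ∅ s) (hsM : s ∉ Finset.univ.image e)
    (hend : ¬ AvailableEdge G b (Finset.univ.image e) s) :
    ∃ v ∈ s, ∃ J : Finset (Fin k), b v ≤ J.card ∧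
      ∀ j ∈ J, v ∈ e j ∧ AvailableEdge G b (prefixSet e (j : ℕ)) s := by
  classical
  have hex : ∃ n, ¬ AvailableEdge G b (prefixSet e n) s :=
    ⟨k, by rwa [prefixSet_of_le e le_rfl]⟩
  obtain ⟨v, hvs, hv⟩ := (isBMatching_prefixSet ha (Nat.find hex)).exists_saturated hs.1
    (fun h => hsM (prefixSet_subset_image e _ h)) (Nat.find_spec hex)
  refine ⟨v, hvs, Finset.univ.filter (fun j : Fin k => (j : ℕ) < Nat.find hex ∧ v ∈ e j), ?_, ?_⟩
  · refine hv.trans ?_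
    rw [prefixSet, Finset.filter_image, Finset.filter_filter]
    exact Finset.card_image_le
  · intro j hj
    simp only [Finset.mem_filter, Finset.mem_univ, true_and] at hj
    exact ⟨hj.2, not_not.1 (Nat.find_min hex hj.1)⟩

end BMatching

/-- A submodular function increases by at most the sum of the marginal gains. -/
lemma submodular_union_le_add_sum {α : Type*} [DecidableEq α] {E : Finset α}
    {f : Finset α → ℝ}
    (hsub : ∀ A B : Finset α, A ⊆ B → B ⊆ E → ∀ e ∈ E, e ∉ B →
      f (B ∪ {e}) - f B ≤ f (A ∪ {e}) - f A)
    {M S : Finset α} (hM : M ⊆ E) (hS : S ⊆ E) (hd : Disjoint M S) :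
    f (M ∪ S) ≤ f M + ∑ s ∈ S, (f (M ∪ {s}) - f M) := by
  induction S using Finset.induction_on with
  | empty => simp
  | insert a S haS ih =>
    rw [Finset.insert_subset_iff] at hS
    rw [Finset.disjoint_insert_right] at hd
    have h1 := ih hS.2 hd.2
    have h2 := hsub M (M ∪ S) Finset.subset_union_left (Finset.union_subset hM hS.2) a hS.1
      (by simp [hd.1, haS])
    have h3 : M ∪ S ∪ {a} = M ∪ insert a S := by
      ext x
      simp
    rw [h3] at h2
    rw [Finset.sum_insert haS]
    linarith

/-- If every value of `r` on `S` is at most every value of `w` on `T`, and `T` has at least as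
many elements as `S`, then the sums are ordered in the same way. -/
lemma sum_le_sum_of_card_le {α β : Type*} {S : Finset α} {T : Finset β} {r : α → ℝ} {w : β → ℝ}
    (hcard : S.card ≤ T.card) (hw : ∀ t ∈ T, 0 ≤ w t) (h : ∀ s ∈ S, ∀ t ∈ T, r s ≤ w t) :
    ∑ s ∈ S, r s ≤ ∑ t ∈ T, w t := by
  rcases S.eq_empty_or_nonempty with rfl | hS
  · simpa using Finset.sum_nonneg hw
  have hT : (0 : ℝ) < T.card := by exact_mod_cast hS.card_pos.trans_le hcard
  have h1 : ∑ s ∈ S, ∑ _t ∈ T, r s ≤ ∑ _s ∈ S, ∑ t ∈ T, w t :=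
    Finset.sum_le_sum fun s hs => Finset.sum_le_sum fun t ht => h s hs t ht
  simp only [Finset.sum_const, nsmul_eq_mul, ← Finset.mul_sum] at h1
  have h2 : (S.card : ℝ) * ∑ t ∈ T, w t ≤ T.card * ∑ t ∈ T, w t :=
    mul_le_mul_of_nonneg_right (by exact_mod_cast hcard) (Finset.sum_nonneg hw)
  exact le_of_mul_le_mul_left (h1.trans h2) hT

/-- Any maximal `b`-matching `M = {e₁, …, e_k}` that is
`ε`-locally dominant with respect to a normalized monotone submodular function `f`
satisfies `f(M) ≥ (ε / (2 + ε)) · f(M*)` for every `b`-matching `M*`. -/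
theorem epsLocallyDominant_approx {V : Type*} [Fintype V] [DecidableEq V]
    (G : SimpleGraph V) [DecidableRel G.Adj] (b : V → ℕ)
    (f : Finset (Sym2 V) → ℝ) (ε : ℝ) (hε0 : 0 < ε) (hε1 : ε ≤ 1)
    (hnorm : f ∅ = 0)
    (hmono : ∀ A B : Finset (Sym2 V), A ⊆ B → B ⊆ G.edgeFinset → f A ≤ f B)
    (hsub : ∀ A B : Finset (Sym2 V), A ⊆ B → B ⊆ G.edgeFinset →
      ∀ e ∈ G.edgeFinset, e ∉ B → f (B ∪ {e}) - f B ≤ f (A ∪ {e}) - f A)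
    (k : ℕ) (e : Fin k → Sym2 V) (he : Function.Injective e)
    (M : Finset (Sym2 V)) (hM : M = Finset.univ.image e)
    (hMmax : ∀ e' : Sym2 V, ¬ AvailableEdge G b M e')
    (ha : ∀ i : Fin k, AvailableEdge G b (prefixSet e (i : ℕ)) (e i))
    (hb : ∀ i : Fin k, ∀ e' : Sym2 V, EdgeAdjacent (e i) e' →
      AvailableEdge G b (prefixSet e (i : ℕ)) e' →
      ε * (f (prefixSet e (i : ℕ) ∪ {e'}) - f (prefixSet e (i : ℕ))) ≤
        f (prefixSet e (i : ℕ) ∪ {e i}) - f (prefixSet e (i : ℕ)))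
    (Mstar : Finset (Sym2 V)) (hMstar : IsBMatching G b Mstar) :
    (ε / (2 + ε)) * f Mstar ≤ f M := by
  classical
  subst hM
  set M := Finset.univ.image e with hMdef
  have hMb : IsBMatching G b M := by
    have h := isBMatching_prefixSet ha k
    rwa [prefixSet_of_le e le_rfl] at h
  set w : Fin k → ℝ := fun j => f (prefixSet e (j : ℕ) ∪ {e j}) - f (prefixSet e (j : ℕ))
    with hwdef
  have hw0 : ∀ j, 0 ≤ w j := fun j =>
    sub_nonneg.2 (hmono _ _ Finset.subset_union_left (ha j).2.2.1)
  have hwsum : ∑ j, w j = f M := by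
    rw [hwdef, sum_prefixSet_marginal, hnorm, sub_zero]
  have hblock : ∀ s, ∃ v, s ∈ Mstar \ M → v ∈ s ∧ ∃ J : Finset (Fin k), b v ≤ J.card ∧
      ∀ j ∈ J, v ∈ e j ∧ AvailableEdge G b (prefixSet e (j : ℕ)) s := by
    intro s
    by_cases hs : s ∈ Mstar \ M
    · rw [Finset.mem_sdiff] at hs
      obtain ⟨v, hv⟩ := exists_endpoint_blocked ha (s := s)
        ⟨hMstar.1 hs.1, Finset.notMem_empty s, hMstar.mono (by simpa using hs.1)⟩ hs.2 (hMmax s)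
      exact ⟨v, fun _ => hv⟩
    · exact ⟨s.out.1, fun h => absurd h hs⟩
  choose c hc using hblock
  have hvertex : ∀ v, ∑ s ∈ (Mstar \ M).filter (fun s => c s = v), ε * (f (M ∪ {s}) - f M) ≤
      ∑ j ∈ Finset.univ.filter (fun j => v ∈ e j), w j := by
    intro v
    have hT : (Finset.univ.filter (fun j => v ∈ e j)).card ≤ b v := by
      have h := hMb.2 v
      rwa [hMdef, Finset.filter_image, Finset.card_image_of_injective _ he] at h
    have key : ∀ s ∈ (Mstar \ M).filter (fun s => c s = v),
        b v ≤ (Finset.univ.filter (fun j => v ∈ e j)).card ∧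
        ∀ j ∈ Finset.univ.filter (fun j => v ∈ e j),
          AvailableEdge G b (prefixSet e (j : ℕ)) s := by
      intro s hs
      obtain ⟨hsd, rfl⟩ := Finset.mem_filter.1 hs
      obtain ⟨-, J, hJ, hJa⟩ := hc s hsd
      have hsub : J ⊆ Finset.univ.filter (fun j => c s ∈ e j) := fun j hj =>
        Finset.mem_filter.2 ⟨Finset.mem_univ j, (hJa j hj).1⟩
      refine ⟨hJ.trans (Finset.card_le_card hsub), ?_⟩
      rw [← Finset.eq_of_subset_of_card_le hsub (hT.trans hJ)]
      exact fun j hj => (hJa j hj).2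
    refine sum_le_sum_of_card_le ?_ (fun j _ => hw0 j) ?_
    · rcases ((Mstar \ M).filter (fun s => c s = v)).eq_empty_or_nonempty with h | ⟨s, hs⟩
      · simp [h]
      · refine (Finset.card_le_card ?_).trans ((hMstar.2 v).trans (key s hs).1)
        intro t ht
        obtain ⟨htd, rfl⟩ := Finset.mem_filter.1 ht
        exact Finset.mem_filter.2 ⟨(Finset.mem_sdiff.1 htd).1, (hc t htd).1⟩
    · intro s hs j hj
      have hav := (key s hs).2 j hj
      obtain ⟨hsd, rfl⟩ := Finset.mem_filter.1 hs
      have hsM := (Finset.mem_sdiff.1 hsd).2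
      have hne : e j ≠ s := fun h => hsM (h ▸ Finset.mem_image_of_mem e (Finset.mem_univ j))
      refine le_trans ?_ (hb j s ⟨hne, c s, (Finset.mem_filter.1 hj).2, (hc s hsd).1⟩ hav)
      exact mul_le_mul_of_nonneg_left
        (hsub _ _ (prefixSet_subset_image e j) hMb.1 s hav.1 hsM) hε0.le
  have hcharge : ∑ s ∈ Mstar \ M, ε * (f (M ∪ {s}) - f M) ≤ 2 * f M := by
    calc ∑ s ∈ Mstar \ M, ε * (f (M ∪ {s}) - f M)
        = ∑ v, ∑ s ∈ (Mstar \ M).filter (fun s => c s = v), ε * (f (M ∪ {s}) - f M) :=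
          (Finset.sum_fiberwise _ _ _).symm
      _ ≤ ∑ v, ∑ j ∈ Finset.univ.filter (fun j => v ∈ e j), w j :=
          Finset.sum_le_sum fun v _ => hvertex v
      _ = ∑ j, ∑ _v ∈ Finset.univ.filter (fun v => v ∈ e j), w j :=
          Finset.sum_comm' (by simp)
      _ ≤ ∑ j, 2 * w j := by
          refine Finset.sum_le_sum fun j _ => ?_
          rw [Finset.sum_const, nsmul_eq_mul]
          exact mul_le_mul_of_nonneg_right
            (by exact_mod_cast Sym2.card_filter_mem_le_two (e j)) (hw0 j)
      _ = 2 * f M := by rw [← Finset.mul_sum, hwsum]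
  have hS : Mstar \ M ⊆ G.edgeFinset := Finset.sdiff_subset.trans hMstar.1
  have hgain := submodular_union_le_add_sum hsub hMb.1 hS Finset.disjoint_sdiff
  have hle : f Mstar ≤ f (M ∪ (Mstar \ M)) :=
    hmono _ _ (by simp) (Finset.union_subset hMb.1 hS)
  rw [← Finset.mul_sum] at hcharge
  have hmul := mul_le_mul_of_nonneg_left (hle.trans hgain) hε0.le
  rw [div_mul_eq_mul_div, div_le_iff₀ (by linarith)]
  linarith
end

section
/- Let G = (V, E) be a finite simple graph with nonnegative edge weights W : E → ℝ≥0 and let α ∈ [0, 1]. Then the set function f defined on subsets M ⊆ E by f(M) = Σ_{v ∈ V} (Σ_{e ∈ δ(v) ∩ M} W(e))^α, where δ(v) denotes the set of edges incident on vertex v, is normalized, monotone, and submodular. -/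
/-- Real power `x ^ α` with the convention `0 ^ α = 0` (for any exponent). -/
noncomputable def cpow (x α : ℝ) : ℝ := if x = 0 then 0 else Real.rpow x α

/-- A concave function on a convex set of reals has decreasing increments. -/
theorem ConcaveOn.increment_le {s : Set ℝ} {φ : ℝ → ℝ} (hφ : ConcaveOn ℝ s φ) {x y t : ℝ}
    (hx : x ∈ s) (hyt : y + t ∈ s) (hxy : x ≤ y) (ht : 0 ≤ t) :
    φ (y + t) - φ y ≤ φ (x + t) - φ x := by
  rcases hxy.eq_or_lt with rfl | hlt
  · exact le_rfl
  have hd : 0 < (y - x) + t := by linarith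
  have ha : 0 ≤ t / ((y - x) + t) := by positivity
  have hb : 0 ≤ (y - x) / ((y - x) + t) := div_nonneg (by linarith) hd.le
  have hab : t / ((y - x) + t) + (y - x) / ((y - x) + t) = 1 := by
    rw [← add_div, add_comm t, div_self hd.ne']
  have h₁ := hφ.2 hx hyt ha hb hab
  have h₂ := hφ.2 hx hyt hb ha (by rw [add_comm, hab])
  simp only [smul_eq_mul] at h₁ h₂
  have e₁ : t / ((y - x) + t) * x + (y - x) / ((y - x) + t) * (y + t) = y := by
    field_simp
    ring
  have e₂ : (y - x) / ((y - x) + t) * x + t / ((y - x) + t) * (y + t) = x + t := by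
    field_simp
    ring
  rw [e₁] at h₁
  rw [e₂] at h₂
  linear_combination h₁ + h₂ - (φ x + φ (y + t)) * hab

theorem cpow_zero_left (α : ℝ) : cpow 0 α = 0 := if_pos rfl

theorem cpow_zero_right (x : ℝ) : cpow x 0 = if x = 0 then 0 else 1 := by
  simp [cpow]

theorem cpow_eq_rpow {α : ℝ} (hα : α ≠ 0) (x : ℝ) : cpow x α = x ^ α := by
  unfold cpow
  split_ifs with h
  · rw [h, Real.zero_rpow hα]
  · rfl

theorem cpow_le_cpow {α x y : ℝ} (hα : 0 ≤ α) (hx : 0 ≤ x) (hxy : x ≤ y) :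
    cpow x α ≤ cpow y α := by
  rcases eq_or_ne α 0 with rfl | h
  · simp only [cpow_zero_right]
    split_ifs <;> grind
  · simpa only [cpow_eq_rpow h] using Real.rpow_le_rpow hx hxy hα

theorem cpow_increment_le {α x y t : ℝ} (hα₀ : 0 ≤ α) (hα₁ : α ≤ 1) (hx : 0 ≤ x) (hxy : x ≤ y)
    (ht : 0 ≤ t) : cpow (y + t) α - cpow y α ≤ cpow (x + t) α - cpow x α := by
  rcases eq_or_ne α 0 with rfl | h
  · simp only [cpow_zero_right]
    split_ifs <;> grind
  · simp only [cpow_eq_rpow h]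
    exact (Real.concaveOn_rpow hα₀ hα₁).increment_le (Set.mem_Ici.2 hx)
      (Set.mem_Ici.2 (by linarith)) hxy ht

theorem Finset.sum_filter_union_singleton {ι : Type*} [DecidableEq ι] (p : ι → Prop)
    [DecidablePred p] (w : ι → ℝ) {M : Finset ι} {e : ι} (he : e ∉ M) :
    ∑ i ∈ (M ∪ {e}).filter p, w i = ∑ i ∈ M.filter p, w i + if p e then w e else 0 := by
  rw [Finset.sum_filter, Finset.sum_filter, Finset.sum_union (Finset.disjoint_singleton_right.2 he),
    Finset.sum_singleton]

/-- For a finite simple graph `G` with nonnegative edge weights `W`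
and `α ∈ [0, 1]`, the set function
`f(M) = ∑_{v ∈ V} (∑_{e ∈ δ(v) ∩ M} W e)^α` on subsets `M` of the edge set
is normalized, monotone, and submodular. -/
theorem concavePolynomial_submodular {V : Type*} [Fintype V] [DecidableEq V]
    (G : SimpleGraph V) [DecidableRel G.Adj]
    (W : Sym2 V → ℝ) (hW : ∀ e ∈ G.edgeFinset, 0 ≤ W e)
    (α : ℝ) (hα0 : 0 ≤ α) (hα1 : α ≤ 1)
    (f : Finset (Sym2 V) → ℝ)
    (hf : ∀ M : Finset (Sym2 V),
      f M = ∑ v : V, cpow (∑ e ∈ M.filter (fun e => v ∈ e), W e) α) :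
    f ∅ = 0 ∧
    (∀ A B : Finset (Sym2 V), A ⊆ B → B ⊆ G.edgeFinset → f A ≤ f B) ∧
    (∀ A B : Finset (Sym2 V), A ⊆ B → B ⊆ G.edgeFinset →
      ∀ e ∈ G.edgeFinset, e ∉ B → f (B ∪ {e}) - f B ≤ f (A ∪ {e}) - f A) := by
  have hnonneg : ∀ M ⊆ G.edgeFinset, ∀ v : V, 0 ≤ ∑ e ∈ M.filter (fun e => v ∈ e), W e :=
    fun M hM v => Finset.sum_nonneg fun e he => hW e (hM (Finset.mem_filter.1 he).1)
  have hmono : ∀ A B : Finset (Sym2 V), A ⊆ B → B ⊆ G.edgeFinset → ∀ v : V,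
      ∑ e ∈ A.filter (fun e => v ∈ e), W e ≤ ∑ e ∈ B.filter (fun e => v ∈ e), W e :=
    fun A B hAB hB v => Finset.sum_le_sum_of_subset_of_nonneg (Finset.filter_subset_filter _ hAB)
      fun e he _ => hW e (hB (Finset.mem_filter.1 he).1)
  refine ⟨by simp [hf, cpow_zero_left], fun A B hAB hB => ?_, fun A B hAB hB e he heB => ?_⟩
  · rw [hf, hf]
    exact Finset.sum_le_sum fun v _ =>
      cpow_le_cpow hα0 (hnonneg A (hAB.trans hB) v) (hmono A B hAB hB v)
  · simp only [hf, ← Finset.sum_sub_distrib]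
    refine Finset.sum_le_sum fun v _ => ?_
    rw [Finset.sum_filter_union_singleton _ W heB,
      Finset.sum_filter_union_singleton _ W fun h => heB (hAB h)]
    refine cpow_increment_le hα0 hα1 (hnonneg A (hAB.trans hB) v) (hmono A B hAB hB v) ?_
    split_ifs
    · exact hW e he
    · exact le_rfl
end
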